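/- If f : X → Y is a continuous surjection between compact Hausdorff spaces, then the induced pushforward map P(f) : P(X) → P(Y) between the spaces of Radon probability measures (with the weak-* topology) is surjective. -/

import Mathlib

open MeasureTheory
open Set Filter Topology

/-- A finitely additive nonnegative set function `m` on an algebra of sets `dom` that is inner
regular with respect to the family `𝒦`. Values of `m` outside `dom` are irrelevant. -/
structure IsRegularCharge {X : Type*} (𝒦 dom : Set (Set X)) (m : Set X → ℝ) : Prop where
  isSetAlgebra : IsSetAlgebra dom
  nonneg : ∀ ⦃A⦄, A ∈ dom → 0 ≤ m A
  inter_add_sdiff : ∀ ⦃A B⦄, A ∈ dom → B ∈ dom → m (A ∩ B) + m (A \ B) = m A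
  regular : ∀ ⦃A⦄, A ∈ dom → ∀ ⦃ε : ℝ⦄, 0 < ε → ∃ L ∈ 𝒦, L ∈ dom ∧ L ⊆ A ∧ m A < m L + ε

/-- The outer set function of a charge. -/
noncomputable def outerCharge {X : Type*} (dom : Set (Set X)) (m : Set X → ℝ) (A : Set X) : ℝ :=
  sInf (m '' {B | B ∈ dom ∧ A ⊆ B})

/-- The inner set function of a charge. -/
noncomputable def innerCharge {X : Type*} (dom : Set (Set X)) (m : Set X → ℝ) (A : Set X) : ℝ :=
  m univ - outerCharge dom m Aᶜ

namespace IsRegularCharge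

variable {X : Type*} {𝒦 dom : Set (Set X)} {m : Set X → ℝ} {A B K : Set X}

theorem empty (h : IsRegularCharge 𝒦 dom m) : m ∅ = 0 := by
  have := h.inter_add_sdiff h.isSetAlgebra.empty_mem h.isSetAlgebra.empty_mem
  simpa using this

theorem add_compl (h : IsRegularCharge 𝒦 dom m) (hA : A ∈ dom) : m A + m Aᶜ = m univ := by
  have := h.inter_add_sdiff h.isSetAlgebra.univ_mem hA
  rwa [univ_inter, ← compl_eq_univ_sdiff] at this

theorem mono (h : IsRegularCharge 𝒦 dom m) (hA : A ∈ dom) (hB : B ∈ dom) (hAB : A ⊆ B) :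
    m A ≤ m B := by
  have h₁ := h.inter_add_sdiff hB hA
  have h₂ := h.nonneg (h.isSetAlgebra.sdiff_mem hB hA)
  rw [inter_eq_self_of_subset_right hAB] at h₁
  linarith

theorem sdiff_of_subset (h : IsRegularCharge 𝒦 dom m) (hA : A ∈ dom) (hB : B ∈ dom)
    (hAB : A ⊆ B) : m (B \ A) = m B - m A := by
  have h₁ := h.inter_add_sdiff hB hA
  rw [inter_eq_self_of_subset_right hAB] at h₁
  linarith

theorem union_of_disjoint (h : IsRegularCharge 𝒦 dom m) (hA : A ∈ dom) (hB : B ∈ dom)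
    (hAB : Disjoint A B) : m (A ∪ B) = m A + m B := by
  have h₁ := h.inter_add_sdiff (h.isSetAlgebra.union_mem hA hB) hA
  rw [union_inter_cancel_left, union_sdiff_cancel_left hAB.le_bot] at h₁
  exact h₁.symm

theorem union_le (h : IsRegularCharge 𝒦 dom m) (hA : A ∈ dom) (hB : B ∈ dom) :
    m (A ∪ B) ≤ m A + m B := by
  rw [← union_sdiff_self, h.union_of_disjoint hA (h.isSetAlgebra.sdiff_mem hB hA)
    disjoint_sdiff_right]
  gcongr
  exact h.mono (h.isSetAlgebra.sdiff_mem hB hA) hB sdiff_subset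

theorem outerCharge_le (h : IsRegularCharge 𝒦 dom m) (hB : B ∈ dom) (hAB : A ⊆ B) :
    outerCharge dom m A ≤ m B :=
  csInf_le ⟨0, by rintro _ ⟨C, hC, rfl⟩; exact h.nonneg hC.1⟩ ⟨B, ⟨hB, hAB⟩, rfl⟩

theorem exists_lt_outerCharge_add (h : IsRegularCharge 𝒦 dom m) (A : Set X) {ε : ℝ}
    (hε : 0 < ε) : ∃ B ∈ dom, A ⊆ B ∧ m B < outerCharge dom m A + ε := by
  have hne : (m '' {B | B ∈ dom ∧ A ⊆ B}).Nonempty :=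
    ⟨_, univ, ⟨h.isSetAlgebra.univ_mem, subset_univ A⟩, rfl⟩
  obtain ⟨_, ⟨B, hB, rfl⟩, hlt⟩ := exists_lt_of_csInf_lt hne (lt_add_of_pos_right _ hε)
  exact ⟨B, hB.1, hB.2, hlt⟩

theorem outerCharge_nonneg (h : IsRegularCharge 𝒦 dom m) (A : Set X) :
    0 ≤ outerCharge dom m A := by
  refine Real.sInf_nonneg ?_
  rintro _ ⟨C, hC, rfl⟩
  exact h.nonneg hC.1

theorem outerCharge_eq (h : IsRegularCharge 𝒦 dom m) (hA : A ∈ dom) :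
    outerCharge dom m A = m A := by
  refine le_antisymm (h.outerCharge_le hA subset_rfl) (le_of_forall_pos_le_add fun ε hε ↦ ?_)
  obtain ⟨B, hB, hAB, hlt⟩ := h.exists_lt_outerCharge_add A hε
  exact (h.mono hA hB hAB).trans hlt.le

theorem outerCharge_inter_add_sdiff (h : IsRegularCharge 𝒦 dom m) (A : Set X) (hB : B ∈ dom) :
    outerCharge dom m (A ∩ B) + outerCharge dom m (A \ B) = outerCharge dom m A := by
  refine le_antisymm (le_of_forall_pos_le_add fun ε hε ↦ ?_)
    (le_of_forall_pos_le_add fun ε hε ↦ ?_)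
  · obtain ⟨C, hC, hAC, hlt⟩ := h.exists_lt_outerCharge_add A hε
    have h₁ := h.outerCharge_le (h.isSetAlgebra.inter_mem hC hB) (inter_subset_inter_left B hAC)
    have h₂ := h.outerCharge_le (h.isSetAlgebra.sdiff_mem hC hB)
      (sdiff_subset_sdiff_left (t := B) hAC)
    linarith [h.inter_add_sdiff hC hB]
  · obtain ⟨C, hC, hAC, hlt⟩ := h.exists_lt_outerCharge_add (A ∩ B) (half_pos hε)
    obtain ⟨D, hD, hAD, hlt'⟩ := h.exists_lt_outerCharge_add (A \ B) (half_pos hε)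
    have h₁ : A ⊆ C ∪ D := by
      rw [← inter_union_sdiff A B]
      exact union_subset_union hAC hAD
    linarith [h.outerCharge_le (h.isSetAlgebra.union_mem hC hD) h₁, h.union_le hC hD]

theorem innerCharge_inter_add_sdiff (h : IsRegularCharge 𝒦 dom m) (A : Set X) (hB : B ∈ dom) :
    innerCharge dom m (A ∩ B) + innerCharge dom m (A \ B) = innerCharge dom m A := by
  have hBc := h.isSetAlgebra.compl_mem hB
  have h₁ := h.outerCharge_inter_add_sdiff (A ∩ B)ᶜ hB
  have h₂ := h.outerCharge_inter_add_sdiff (A \ B)ᶜ hB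
  have h₃ := h.outerCharge_inter_add_sdiff Aᶜ hB
  have e₁ : (A ∩ B)ᶜ ∩ B = Aᶜ ∩ B := by grind
  have e₂ : (A ∩ B)ᶜ \ B = Bᶜ := by grind
  have e₃ : (A \ B)ᶜ ∩ B = B := by grind
  have e₄ : (A \ B)ᶜ \ B = Aᶜ \ B := by grind
  rw [e₁, e₂, h.outerCharge_eq hBc] at h₁
  rw [e₃, e₄, h.outerCharge_eq hB] at h₂
  unfold innerCharge
  linarith [h.add_compl hB]

theorem le_innerCharge (h : IsRegularCharge 𝒦 dom m) (hB : B ∈ dom) (hBA : B ⊆ A) :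
    m B ≤ innerCharge dom m A := by
  have := h.outerCharge_le (h.isSetAlgebra.compl_mem hB) (compl_subset_compl.2 hBA)
  unfold innerCharge
  linarith [h.add_compl hB]

theorem exists_innerCharge_lt_add (h : IsRegularCharge 𝒦 dom m) (A : Set X) {ε : ℝ}
    (hε : 0 < ε) : ∃ B ∈ dom, B ⊆ A ∧ innerCharge dom m A < m B + ε := by
  obtain ⟨C, hC, hAC, hlt⟩ := h.exists_lt_outerCharge_add Aᶜ hε
  refine ⟨Cᶜ, h.isSetAlgebra.compl_mem hC, compl_subset_comm.1 hAC, ?_⟩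
  unfold innerCharge
  linarith [h.add_compl hC]

theorem outerCharge_inter_add_innerCharge_sdiff (h : IsRegularCharge 𝒦 dom m) (hA : A ∈ dom)
    (K : Set X) : outerCharge dom m (A ∩ K) + innerCharge dom m (A \ K) = m A := by
  have h₁ := h.outerCharge_inter_add_sdiff (A \ K)ᶜ hA
  have e₁ : (A \ K)ᶜ ∩ A = A ∩ K := by grind
  have e₂ : (A \ K)ᶜ \ A = Aᶜ := by grind
  rw [e₁, e₂, h.outerCharge_eq (h.isSetAlgebra.compl_mem hA)] at h₁
  unfold innerCharge
  linarith [h.add_compl hA]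

/-- A regular charge can be extended to any additional member of the lattice `𝒦`. -/
theorem exists_extension_mem (h : IsRegularCharge 𝒦 dom m)
    (hunion : ∀ K ∈ 𝒦, ∀ L ∈ 𝒦, K ∪ L ∈ 𝒦) (hinter : ∀ K ∈ 𝒦, ∀ L ∈ 𝒦, K ∩ L ∈ 𝒦)
    (hK : K ∈ 𝒦) :
    ∃ dom' m', IsRegularCharge 𝒦 dom' m' ∧ dom ⊆ dom' ∧ EqOn m' m dom ∧ K ∈ dom' := by
  have alg := h.isSetAlgebra
  have eK (E F : Set X) : (E ∩ K ∪ F \ K) ∩ K = E ∩ K := by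
    ext x
    simp only [mem_union, mem_inter_iff, Set.mem_sdiff]
    tauto
  have eKc (E F : Set X) : (E ∩ K ∪ F \ K) \ K = F \ K := by
    ext x
    simp only [mem_union, mem_inter_iff, Set.mem_sdiff]
    tauto
  refine ⟨{S | ∃ E ∈ dom, ∃ F ∈ dom, S = E ∩ K ∪ F \ K},
    fun S ↦ outerCharge dom m (S ∩ K) + innerCharge dom m (S \ K), ⟨⟨?_, ?_, ?_⟩, ?_, ?_, ?_⟩,
    fun A hA ↦ ⟨A, hA, A, hA, (inter_union_sdiff A K).symm⟩,
    fun A hA ↦ h.outerCharge_inter_add_innerCharge_sdiff hA K,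
    ⟨univ, alg.univ_mem, ∅, alg.empty_mem, by simp⟩⟩
  · exact ⟨∅, alg.empty_mem, ∅, alg.empty_mem, by simp⟩
  · rintro _ ⟨E, hE, F, hF, rfl⟩
    refine ⟨Eᶜ, alg.compl_mem hE, Fᶜ, alg.compl_mem hF, ?_⟩
    ext x
    simp only [mem_compl_iff, mem_union, mem_inter_iff, Set.mem_sdiff]
    tauto
  · rintro _ _ ⟨E, hE, F, hF, rfl⟩ ⟨E', hE', F', hF', rfl⟩
    refine ⟨E ∪ E', alg.union_mem hE hE', F ∪ F', alg.union_mem hF hF', ?_⟩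
    rw [union_inter_distrib_right, union_sdiff_distrib, union_union_union_comm]
  · intro S _
    have h₁ := h.le_innerCharge alg.empty_mem (empty_subset (S \ K))
    rw [h.empty] at h₁
    exact add_nonneg (h.outerCharge_nonneg _) h₁
  · rintro S _ - ⟨E, hE, F, hF, rfl⟩
    have e₁ : S ∩ (E ∩ K ∪ F \ K) ∩ K = S ∩ K ∩ E := by
      rw [inter_assoc, eK, inter_comm E, inter_assoc]
    have e₂ : (S \ (E ∩ K ∪ F \ K)) ∩ K = (S ∩ K) \ E := by
      ext x
      simp only [mem_union, mem_inter_iff, Set.mem_sdiff]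
      tauto
    have e₃ : (S ∩ (E ∩ K ∪ F \ K)) \ K = (S \ K) ∩ F := by
      ext x
      simp only [mem_union, mem_inter_iff, Set.mem_sdiff]
      tauto
    have e₄ : (S \ (E ∩ K ∪ F \ K)) \ K = (S \ K) \ F := by
      ext x
      simp only [mem_union, mem_inter_iff, Set.mem_sdiff]
      tauto
    simp only [e₁, e₂, e₃, e₄]
    linarith [h.outerCharge_inter_add_sdiff (S ∩ K) hE,
      h.innerCharge_inter_add_sdiff (S \ K) hF]
  · rintro _ ⟨E, hE, F, hF, rfl⟩ ε hε
    have hε₃ : 0 < ε / 3 := by positivity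
    obtain ⟨B, hB, hBF, hB'⟩ := h.exists_innerCharge_lt_add (F \ K) hε₃
    obtain ⟨L, hL𝒦, hL, hLB, hL'⟩ := h.regular hB hε₃
    obtain ⟨M, hM𝒦, hM, hME, hM'⟩ := h.regular hE hε₃
    have hLF : L ⊆ F \ K := hLB.trans hBF
    have hLK : L \ K = L := sdiff_eq_left.2 (disjoint_sdiff_left.mono_left hLF)
    refine ⟨M ∩ K ∪ L, hunion _ (hinter _ hM𝒦 _ hK) _ hL𝒦, ⟨M, hM, L, hL, by rw [hLK]⟩,
      union_subset_union (inter_subset_inter_left K hME) hLF, ?_⟩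
    have e₁ := eK M L
    have e₂ := eKc M L
    rw [hLK] at e₁ e₂
    rw [e₁, e₂, eK, eKc]
    have h₃ := h.outerCharge_inter_add_sdiff (E ∩ K) hM
    have h₄ := h.outerCharge_le (alg.sdiff_mem hE hM)
      (sdiff_subset_sdiff_left (t := M) (inter_subset_left : E ∩ K ⊆ E))
    rw [h.sdiff_of_subset hM hE hME] at h₄
    rw [inter_right_comm, inter_eq_self_of_subset_right hME] at h₃
    linarith [h.le_innerCharge hL (subset_refl L)]

/-- A regular charge extends to a regular charge defined on the whole lattice `𝒦`. -/
theorem exists_extension (h : IsRegularCharge 𝒦 dom m)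
    (hunion : ∀ K ∈ 𝒦, ∀ L ∈ 𝒦, K ∪ L ∈ 𝒦) (hinter : ∀ K ∈ 𝒦, ∀ L ∈ 𝒦, K ∩ L ∈ 𝒦) :
    ∃ dom' m', IsRegularCharge 𝒦 dom' m' ∧ dom ⊆ dom' ∧ EqOn m' m dom ∧ 𝒦 ⊆ dom' := by
  let P := {p : Set (Set X) × (Set X → ℝ) //
    IsRegularCharge 𝒦 p.1 p.2 ∧ dom ⊆ p.1 ∧ EqOn p.2 m dom}
  let r : P → P → Prop := fun p q ↦ p.1.1 ⊆ q.1.1 ∧ EqOn q.1.2 p.1.2 p.1.1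
  have : Nonempty P := ⟨⟨(dom, m), h, subset_rfl, fun _ _ ↦ rfl⟩⟩
  have hrefl (p : P) : r p p := ⟨subset_rfl, fun _ _ ↦ rfl⟩
  have htrans {p q s : P} (hpq : r p q) (hqs : r q s) : r p s :=
    ⟨hpq.1.trans hqs.1, fun A hA ↦ (hqs.2 (hpq.1 hA)).trans (hpq.2 hA)⟩
  obtain ⟨p, hp⟩ := exists_maximal_of_nonempty_chains_bounded (r := r) (fun c hc hne ↦ by
    have hdir (p : P) (hp : p ∈ c) (q : P) (hq : q ∈ c) : ∃ s ∈ c, r p s ∧ r q s := by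
      by_cases hpq : p = q
      · exact ⟨p, hp, hrefl p, hpq ▸ hrefl p⟩
      · rcases hc hp hq hpq with h' | h'
        · exact ⟨q, hq, h', hrefl q⟩
        · exact ⟨p, hp, hrefl p, h'⟩
    classical
    let D : Set (Set X) := {A | ∃ p ∈ c, A ∈ p.1.1}
    let M : Set X → ℝ := fun A ↦ if hA : A ∈ D then hA.choose.1.2 A else 0
    have hM (p : P) (hp : p ∈ c) : EqOn M p.1.2 p.1.1 := fun A hA ↦ by
      have hAD : A ∈ D := ⟨p, hp, hA⟩
      obtain ⟨s, hs, h₁, h₂⟩ := hdir p hp _ hAD.choose_spec.1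
      rw [show M A = hAD.choose.1.2 A from dif_pos hAD, ← h₁.2 hA, ← h₂.2 hAD.choose_spec.2]
    have hD (p : P) (hp : p ∈ c) : p.1.1 ⊆ D := fun A hA ↦ ⟨p, hp, hA⟩
    have hcommon {A B : Set X} (hA : A ∈ D) (hB : B ∈ D) : ∃ p ∈ c, A ∈ p.1.1 ∧ B ∈ p.1.1 := by
      obtain ⟨p, hp, hA⟩ := hA
      obtain ⟨q, hq, hB⟩ := hB
      obtain ⟨s, hs, h₁, h₂⟩ := hdir p hp q hq
      exact ⟨s, hs, h₁.1 hA, h₂.1 hB⟩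
    obtain ⟨p₀, hp₀⟩ := hne
    refine ⟨⟨(D, M), ⟨⟨?_, ?_, ?_⟩, ?_, ?_, ?_⟩, p₀.2.2.1.trans (hD p₀ hp₀),
      fun A hA ↦ (hM p₀ hp₀ (p₀.2.2.1 hA)).trans (p₀.2.2.2 hA)⟩,
      fun p hp ↦ ⟨hD p hp, hM p hp⟩⟩
    · exact hD p₀ hp₀ p₀.2.1.isSetAlgebra.empty_mem
    · rintro A ⟨p, hp, hA⟩
      exact hD p hp (p.2.1.isSetAlgebra.compl_mem hA)
    · intro A B hA hB
      obtain ⟨p, hp, hA, hB⟩ := hcommon hA hB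
      exact hD p hp (p.2.1.isSetAlgebra.union_mem hA hB)
    · rintro A ⟨p, hp, hA⟩
      exact (p.2.1.nonneg hA).trans_eq (hM p hp hA).symm
    · intro A B hA hB
      obtain ⟨p, hp, hA, hB⟩ := hcommon hA hB
      have e := p.2.1.inter_add_sdiff hA hB
      rwa [← hM p hp hA, ← hM p hp (p.2.1.isSetAlgebra.inter_mem hA hB),
        ← hM p hp (p.2.1.isSetAlgebra.sdiff_mem hA hB)] at e
    · rintro A ⟨p, hp, hA⟩ ε hε
      obtain ⟨L, hL𝒦, hL, hLA, hlt⟩ := p.2.1.regular hA hε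
      rw [← hM p hp hA, ← hM p hp hL] at hlt
      exact ⟨L, hL𝒦, hD p hp hL, hLA, hlt⟩) htrans
  refine ⟨p.1.1, p.1.2, p.2.1, p.2.2.1, p.2.2.2, fun K hK ↦ ?_⟩
  obtain ⟨dom', m', h', hsub, heq, hK'⟩ := p.2.1.exists_extension_mem hunion hinter hK
  exact (hp ⟨(dom', m'), h', p.2.2.1.trans hsub,
    fun A hA ↦ (heq (p.2.2.1 hA)).trans (p.2.2.2 hA)⟩ ⟨hsub, heq⟩).1 hK'

/-- A regular charge that is continuous at `∅` along decreasing sequences in `𝒦` is continuous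
at `∅` along all decreasing sequences in its domain. -/
theorem tendsto_zero_of_antitone (h : IsRegularCharge 𝒦 dom m)
    (hinter : ∀ K ∈ 𝒦, ∀ L ∈ 𝒦, K ∩ L ∈ 𝒦)
    (hcont : ∀ L : ℕ → Set X, (∀ n, L n ∈ 𝒦) → (∀ n, L n ∈ dom) → Antitone L →
      ⋂ n, L n = ∅ → Tendsto (fun n ↦ m (L n)) atTop (𝓝 0))
    {A : ℕ → Set X} (hA : ∀ n, A n ∈ dom) (hanti : Antitone A) (hempty : ⋂ n, A n = ∅) :
    Tendsto (fun n ↦ m (A n)) atTop (𝓝 0) := by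
  have alg := h.isSetAlgebra
  refine tendsto_order.2 ⟨fun a ha ↦ .of_forall fun n ↦ ha.trans_le (h.nonneg (hA n)),
    fun ε hε ↦ ?_⟩
  have hδ (n : ℕ) : 0 < ε / 2 * (1 / 2) ^ (n + 1) := by positivity
  choose L hL𝒦 hL hLA hlt using fun n ↦ h.regular (hA n) (hδ n)
  let M : ℕ → Set X := fun n ↦ Nat.rec (L 0) (fun n S ↦ S ∩ L (n + 1)) n
  have hMsucc (n : ℕ) : M (n + 1) = M n ∩ L (n + 1) := rfl
  have hM𝒦 (n : ℕ) : M n ∈ 𝒦 := by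
    induction n with
    | zero => exact hL𝒦 0
    | succ n ih => exact hinter _ ih _ (hL𝒦 _)
  have hM (n : ℕ) : M n ∈ dom := by
    induction n with
    | zero => exact hL 0
    | succ n ih => exact alg.inter_mem ih (hL _)
  have hMA (n : ℕ) : M n ⊆ A n := by
    cases n with
    | zero => exact hLA 0
    | succ n => exact inter_subset_right.trans (hLA _)
  have hbound (n : ℕ) : m (A n) - m (M n) ≤ ε / 2 * (1 - (1 / 2) ^ (n + 1)) := by
    induction n with
    | zero =>
      have := hlt 0
      change m (A 0) - m (L 0) ≤ _
      linarith
    | succ n ih =>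
      have hsub : A (n + 1) \ M (n + 1) ⊆ (A n \ M n) ∪ (A (n + 1) \ L (n + 1)) := by
        have := hanti n.le_succ
        rw [hMsucc]
        grind
      have h₁ := alg.sdiff_mem (hA n) (hM n)
      have h₂ := alg.sdiff_mem (hA (n + 1)) (hL (n + 1))
      have h₀ := alg.sdiff_mem (hA (n + 1)) (hM (n + 1))
      have h₃ := (h.mono h₀ (alg.union_mem h₁ h₂) hsub).trans (h.union_le h₁ h₂)
      rw [h.sdiff_of_subset (hM _) (hA _) (hMA _), h.sdiff_of_subset (hM _) (hA _) (hMA _),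
        h.sdiff_of_subset (hL _) (hA _) (hLA _)] at h₃
      have h₄ := hlt (n + 1)
      have h₅ : ((1 : ℝ) / 2) ^ (n + 1) = 2 * (1 / 2) ^ (n + 1 + 1) := by ring
      rw [h₅] at ih
      linarith
  have hMtendsto := hcont M hM𝒦 hM (antitone_nat_of_succ_le fun n ↦ inter_subset_left)
    (subset_empty_iff.1 (hempty ▸ iInter_mono hMA))
  filter_upwards [(tendsto_order.1 hMtendsto).2 (ε / 2) (half_pos hε)] with n hn
  have := hbound n
  have := hδ n
  linarith

/-- A regular charge that is continuous at `∅` along decreasing sequences in `𝒦` extends to a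
measure. -/
theorem exists_measure (h : IsRegularCharge 𝒦 dom m)
    (hinter : ∀ K ∈ 𝒦, ∀ L ∈ 𝒦, K ∩ L ∈ 𝒦)
    (hcont : ∀ L : ℕ → Set X, (∀ n, L n ∈ 𝒦) → (∀ n, L n ∈ dom) → Antitone L →
      ⋂ n, L n = ∅ → Tendsto (fun n ↦ m (L n)) atTop (𝓝 0))
    [mX : MeasurableSpace X] (hmX : mX ≤ MeasurableSpace.generateFrom dom) :
    ∃ μ : Measure X, ∀ A ∈ dom, MeasurableSet A → μ A = ENNReal.ofReal (m A) := by
  have ring := h.isSetAlgebra.isSetRing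
  let c : AddContent ENNReal dom := ring.addContent_of_union (fun A ↦ ENNReal.ofReal (m A))
    (by simp [h.empty]) fun hA hB hAB ↦ by
      rw [h.union_of_disjoint hA hB hAB, ENNReal.ofReal_add (h.nonneg hA) (h.nonneg hB)]
  have hc : c.IsSigmaSubadditive := isSigmaSubadditive_of_addContent_iUnion_eq_tsum ring
    fun f hf hUf hd ↦ addContent_iUnion_eq_sum_of_tendsto_zero ring c
      (fun _ _ ↦ ENNReal.ofReal_ne_top) (fun s hs hanti hempty ↦ by
        have hlim := ENNReal.tendsto_ofReal
          (h.tendsto_zero_of_antitone hinter hcont hs hanti hempty)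
        rwa [ENNReal.ofReal_zero] at hlim) hf hUf hd
  exact ⟨c.measure ring.isSetSemiring hmX hc, fun A hA hAm ↦
    (trim_measurableSet_eq _ hAm).trans (c.measureCaratheodory_eq ring.isSetSemiring hc hA)⟩

end IsRegularCharge

/-- The sets that are obtained by gluing closed subsets of `X` along a countable measurable
partition of `Y`. -/
def gluedClosedSets {X Y : Type*} [TopologicalSpace X] [MeasurableSpace Y] (f : X → Y) :
    Set (Set X) :=
  {L | ∃ (C : ℕ → Set X) (g : Y → ℕ), (∀ n, IsClosed (C n)) ∧ Measurable g ∧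
    L = {x | x ∈ C (g (f x))}}

section gluedClosedSets

variable {X Y : Type*} [TopologicalSpace X] [MeasurableSpace Y] {f : X → Y} {K L : Set X}

theorem IsClosed.mem_gluedClosedSets (hL : IsClosed L) : L ∈ gluedClosedSets f :=
  ⟨fun _ ↦ L, fun _ ↦ 0, fun _ ↦ hL, measurable_const, rfl⟩

theorem preimage_mem_gluedClosedSets {B : Set Y} (hB : MeasurableSet B) :
    f ⁻¹' B ∈ gluedClosedSets f := by
  classical
  refine ⟨fun n ↦ {_x | n = 1}, B.indicator 1, fun n ↦ isClosed_const,
    measurable_one.indicator hB, ?_⟩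
  ext x
  by_cases hx : f x ∈ B <;> simp [hx]

theorem union_mem_gluedClosedSets (hK : K ∈ gluedClosedSets f) (hL : L ∈ gluedClosedSets f) :
    K ∪ L ∈ gluedClosedSets f := by
  obtain ⟨C, g, hC, hg, rfl⟩ := hK
  obtain ⟨D, k, hD, hk, rfl⟩ := hL
  refine ⟨fun n ↦ C n.unpair.1 ∪ D n.unpair.2, fun y ↦ Nat.pair (g y) (k y),
    fun n ↦ (hC _).union (hD _), (Measurable.of_discrete (f := fun p : ℕ × ℕ ↦ Nat.pair p.1 p.2)).comp
      (hg.prodMk hk), ?_⟩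
  ext x
  simp

theorem inter_mem_gluedClosedSets (hK : K ∈ gluedClosedSets f) (hL : L ∈ gluedClosedSets f) :
    K ∩ L ∈ gluedClosedSets f := by
  obtain ⟨C, g, hC, hg, rfl⟩ := hK
  obtain ⟨D, k, hD, hk, rfl⟩ := hL
  refine ⟨fun n ↦ C n.unpair.1 ∩ D n.unpair.2, fun y ↦ Nat.pair (g y) (k y),
    fun n ↦ (hC _).inter (hD _), (Measurable.of_discrete (f := fun p : ℕ × ℕ ↦ Nat.pair p.1 p.2)).comp
      (hg.prodMk hk), ?_⟩
  ext x
  simp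

variable [TopologicalSpace Y] [T2Space Y] [CompactSpace X]

theorem measurableSet_image_of_mem_gluedClosedSets [OpensMeasurableSpace Y] (hf : Continuous f)
    (hL : L ∈ gluedClosedSets f) : MeasurableSet (f '' L) := by
  obtain ⟨C, g, hC, hg, rfl⟩ := hL
  have : f '' {x | x ∈ C (g (f x))} = ⋃ n, f '' C n ∩ g ⁻¹' {n} := by
    ext y
    simp only [mem_image, mem_ofPred_eq, mem_iUnion, mem_inter_iff, mem_preimage,
      mem_singleton_iff]
    constructor
    · rintro ⟨x, hx, rfl⟩
      exact ⟨_, ⟨x, hx, rfl⟩, rfl⟩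
    · rintro ⟨_, ⟨x, hx, rfl⟩, rfl⟩
      exact ⟨x, hx, rfl⟩
  rw [this]
  exact .iUnion fun n ↦ ((hC n).isCompact.image hf).measurableSet.inter (hg (.singleton n))

theorem isCompact_inter_fiber_of_mem_gluedClosedSets (hf : Continuous f)
    (hL : L ∈ gluedClosedSets f) (y : Y) : IsCompact (L ∩ f ⁻¹' {y}) := by
  obtain ⟨C, g, hC, hg, rfl⟩ := hL
  have : {x | x ∈ C (g (f x))} ∩ f ⁻¹' {y} = C (g y) ∩ f ⁻¹' {y} := by
    ext x
    simp only [mem_inter_iff, mem_ofPred_eq, mem_preimage, mem_singleton_iff]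
    constructor <;> rintro ⟨h, rfl⟩ <;> exact ⟨h, rfl⟩
  rw [this]
  exact ((hC _).inter (isClosed_singleton.preimage hf)).isCompact

theorem iInter_image_eq_empty_of_mem_gluedClosedSets [T2Space X] (hf : Continuous f)
    {L : ℕ → Set X} (hL : ∀ n, L n ∈ gluedClosedSets f) (hanti : Antitone L)
    (hempty : ⋂ n, L n = ∅) : ⋂ n, f '' L n = ∅ := by
  refine eq_empty_of_forall_notMem fun y hy ↦ ?_
  have hcomp (n : ℕ) := isCompact_inter_fiber_of_mem_gluedClosedSets hf (hL n) y
  obtain ⟨x, hx⟩ := IsCompact.nonempty_iInter_of_sequence_nonempty_isCompact_isClosed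
    (fun n ↦ L n ∩ f ⁻¹' {y}) (fun n ↦ inter_subset_inter_left _ (hanti n.le_succ))
    (fun n ↦ by
      obtain ⟨x, hx, hxy⟩ := mem_iInter.1 hy n
      exact ⟨x, hx, hxy⟩)
    (hcomp 0) (fun n ↦ (hcomp n).isClosed)
  exact (hempty ▸ mem_iInter.2 fun n ↦ (mem_iInter.1 hx n).1 : x ∈ (∅ : Set X))

end gluedClosedSets

/-- The charge `f ⁻¹' B ↦ ν B` on preimages of measurable sets. -/
theorem isRegularCharge_preimage {X Y : Type*} [TopologicalSpace X] [MeasurableSpace Y]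
    {f : X → Y} (hsurj : Function.Surjective f) (ν : Measure Y) [IsFiniteMeasure ν] :
    IsRegularCharge (gluedClosedSets f) {A | ∃ B, MeasurableSet B ∧ f ⁻¹' B = A}
      (fun A ↦ ν.real (f '' A)) where
  isSetAlgebra :=
    { empty_mem := ⟨∅, .empty, rfl⟩
      compl_mem := by
        rintro _ ⟨B, hB, rfl⟩
        exact ⟨Bᶜ, hB.compl, rfl⟩
      union_mem := by
        rintro _ _ ⟨B, hB, rfl⟩ ⟨C, hC, rfl⟩
        exact ⟨B ∪ C, hB.union hC, rfl⟩ }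
  nonneg _ _ := measureReal_nonneg
  inter_add_sdiff := by
    rintro _ _ ⟨B, hB, rfl⟩ ⟨C, hC, rfl⟩
    rw [← preimage_inter, ← preimage_sdiff, hsurj.image_preimage, hsurj.image_preimage,
      hsurj.image_preimage]
    exact measureReal_inter_add_sdiff hC
  regular := by
    rintro _ ⟨B, hB, rfl⟩ ε hε
    exact ⟨f ⁻¹' B, preimage_mem_gluedClosedSets hB, ⟨B, hB, rfl⟩, subset_rfl,
      lt_add_of_pos_right _ hε⟩

/-- Every finite Borel measure, regular or not, lifts along a continuous surjection of compact
Hausdorff spaces. -/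
theorem exists_measure_map_eq {X Y : Type*} [TopologicalSpace X] [CompactSpace X] [T2Space X]
    [MeasurableSpace X] [BorelSpace X] [TopologicalSpace Y] [T2Space Y]
    [MeasurableSpace Y] [BorelSpace Y] {f : X → Y} (hf : Continuous f)
    (hsurj : Function.Surjective f) (ν : Measure Y) [IsFiniteMeasure ν] :
    ∃ μ : Measure X, μ.map f = ν := by
  have hinter : ∀ K ∈ gluedClosedSets f, ∀ L ∈ gluedClosedSets f, K ∩ L ∈ gluedClosedSets f :=
    fun _ hK _ hL ↦ inter_mem_gluedClosedSets hK hL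
  obtain ⟨dom, m, h, hdom, heq, h𝒦⟩ := (isRegularCharge_preimage hsurj ν).exists_extension
    (fun _ hK _ hL ↦ union_mem_gluedClosedSets hK hL) hinter
  have hm {B : Set Y} (hB : MeasurableSet B) : m (f ⁻¹' B) = ν.real B :=
    (heq ⟨B, hB, rfl⟩).trans (congrArg ν.real (hsurj.image_preimage B))
  obtain ⟨μ, hμ⟩ := h.exists_measure hinter (fun L hL hLdom hanti hempty ↦ by
    have himage (n : ℕ) := measurableSet_image_of_mem_gluedClosedSets hf (hL n)
    have hlim : Tendsto (fun n ↦ ν.real (f '' L n)) atTop (𝓝 0) := by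
      have := tendsto_measure_iInter_atTop (μ := ν) (fun n ↦ (himage n).nullMeasurableSet)
        (fun i j hij ↦ image_mono (hanti hij)) ⟨0, measure_ne_top _ _⟩
      rw [iInter_image_eq_empty_of_mem_gluedClosedSets hf hL hanti hempty, measure_empty] at this
      exact (ENNReal.tendsto_toReal ENNReal.zero_ne_top).comp this
    refine squeeze_zero (fun n ↦ h.nonneg (hLdom n)) (fun n ↦ ?_) hlim
    rw [← hm (himage n)]
    exact h.mono (hLdom n) (hdom ⟨_, himage n, rfl⟩) (subset_preimage_image f (L n)))
    (by
      rw [BorelSpace.measurable_eq (α := X), borel_eq_generateFrom_isClosed]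
      exact MeasurableSpace.generateFrom_mono fun C hC ↦
        h𝒦 (IsClosed.mem_gluedClosedSets hC))
  refine ⟨μ, Measure.ext fun B hB ↦ ?_⟩
  rw [Measure.map_apply hf.measurable hB, hμ _ (hdom ⟨B, hB, rfl⟩) (hf.measurable hB), hm hB,
    ofReal_measureReal]

theorem pushforward_probabilityMeasure_surjective
    {X Y : Type*} [TopologicalSpace X] [CompactSpace X] [T2Space X]
    [MeasurableSpace X] [BorelSpace X]
    [TopologicalSpace Y] [CompactSpace Y] [T2Space Y]
    [MeasurableSpace Y] [BorelSpace Y]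
    (f : X → Y) (hf : Continuous f) (hsurj : Function.Surjective f) :
    Function.Surjective
      (fun μ : ProbabilityMeasure X => μ.map hf.measurable.aemeasurable) := by
  intro ν
  obtain ⟨μ, hμ⟩ := exists_measure_map_eq hf hsurj (ν : Measure Y)
  have hprob : IsProbabilityMeasure μ := ⟨by
    rw [← preimage_univ (f := f), ← Measure.map_apply hf.measurable .univ, hμ, measure_univ]⟩
  exact ⟨⟨μ, hprob⟩, Subtype.ext hμ⟩
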